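/- Consider the joint state (orientation, gyro bias, velocity, accel bias, position, point P_f ∈ ℝ³, plane Π ∈ ℝ³) of dimension 21. Let g, P_f, P₁, V₁, P_k ∈ ℝ³, δt ∈ ℝ, R₁ a rotation matrix; let n ∈ ℝ³ with ‖n‖ = 1, d ≠ 0, Π = d·n, {n⊥₁, n⊥₂, n} orthonormal, R_Π = [n⊥₁, n⊥₂, n]; and let Γ₂, Γ₄, A, B ∈ ℝ³ˣ³ be arbitrary. Define the point block row M_p = [Γ₁, Γ₂, −δtI₃, Γ₄, −I₃, I₃, 0₃ₓ₃] with Γ₁ = ⌊(P_f − P₁ − V₁δt + ½δt²g)×⌋R₁, and the plane block row M_π = [Γ_{π1}, A, −δt·nnᵀ, B, −nnᵀ, 0₃ₓ₃, Γ_{π4}]. Let N_{pπ} ∈ ℝ²¹ˣ⁴ have column 1 = (R₁ᵀg; 0; −⌊V₁×⌋g; 0; −⌊P₁×⌋g; −⌊P_f×⌋g; −⌊Π×⌋g) and columns 2–4 given by stacked blocks (0; 0; 0; 0; I₃; I₃; n·e₃ᵀR_Πᵀ). Then M_p·N_{pπ} = 0 and M_π·N_{pπ} = 0. Hence the linearized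 aided INS with one point and one plane feature has at least 4 unobservable directions. -/

import Mathlib

open Matrix

noncomputable section

abbrev V3 : Type := Fin 3 → ℝ
abbrev M3 : Type := Matrix (Fin 3) (Fin 3) ℝ

/-- The skew-symmetric cross-product matrix `⌊v×⌋`. -/
def skew (v : V3) : M3 :=
  !![0, -(v 2), v 1; v 2, 0, -(v 0); -(v 1), v 0, 0]

/-- `R` is a rotation matrix: `RᵀR = I₃` and `det R = 1`. -/
def IsRot (R : M3) : Prop := Rᵀ * R = 1 ∧ R.det = 1

/-- Euclidean norm on `ℝ³`. -/
def norm3 (v : V3) : ℝ := Real.sqrt (v ⬝ᵥ v)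

def e1 : V3 := ![1, 0, 0]
def e2 : V3 := ![0, 1, 0]
def e3 : V3 := ![0, 0, 1]

/-- The 3×3 matrix with the given columns. -/
def cols3 (a b c : V3) : M3 := Matrix.of fun i j => ![a i, b i, c i] j

/-- The 3×3 matrix with the given rows. -/
def rows3 (a b c : V3) : M3 := Matrix.of ![a, b, c]

/-- 21-dimensional joint state index (seven 3-dimensional blocks). -/
abbrev S21 : Type := Fin 3 ⊕ Fin 3 ⊕ Fin 3 ⊕ Fin 3 ⊕ Fin 3 ⊕ Fin 3 ⊕ Fin 3

/-- The 3×21 block row `[A B C D E F G]`. -/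
def row7 (A B C D E F G : M3) : Matrix (Fin 3) S21 ℝ :=
  Matrix.of fun i =>
    Sum.elim (fun j => A i j) (Sum.elim (fun j => B i j) (Sum.elim (fun j => C i j)
      (Sum.elim (fun j => D i j) (Sum.elim (fun j => E i j)
        (Sum.elim (fun j => F i j) (fun j => G i j))))))

/-- The stacked vector `(a; b; c; d; e; f; g)` in ℝ²¹. -/
def col7v (a b c d e f g : V3) : S21 → ℝ :=
  Sum.elim a (Sum.elim b (Sum.elim c (Sum.elim d (Sum.elim e (Sum.elim f g)))))

/-- The 21×3 stacked blocks `(A; B; C; D; E; F; G)`. -/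
def stack7m (A B C D E F G : M3) : Matrix S21 (Fin 3) ℝ :=
  Matrix.of (Sum.elim (fun i => A i) (Sum.elim (fun i => B i) (Sum.elim (fun i => C i)
    (Sum.elim (fun i => D i) (Sum.elim (fun i => E i)
      (Sum.elim (fun i => F i) (fun i => G i)))))))


theorem row7_mulVec_col7v (A B C D E F G : M3) (a b c d e f g : V3) :
    row7 A B C D E F G *ᵥ col7v a b c d e f g =
      A *ᵥ a + B *ᵥ b + C *ᵥ c + D *ᵥ d + E *ᵥ e + F *ᵥ f + G *ᵥ g := by
  ext i
  simp [row7, col7v, mulVec, dotProduct, Fintype.sum_sum_type, add_assoc]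

theorem row7_mul_stack7m (A B C D E F G A' B' C' D' E' F' G' : M3) :
    row7 A B C D E F G * stack7m A' B' C' D' E' F' G' =
      A * A' + B * B' + C * C' + D * D' + E * E' + F * F' + G * G' := by
  ext i j
  simp [row7, stack7m, mul_apply, Fintype.sum_sum_type, add_assoc]

theorem mul_of_sumElim_eq_zero {m k p : Type*} [Fintype k] (M : Matrix m k ℝ) (v : k → ℝ)
    (N : Matrix k p ℝ) (hv : M *ᵥ v = 0) (hN : M * N = 0) :
    M * Matrix.of (fun s => Sum.elim (fun _ : Fin 1 => v s) (fun j => N s j)) = 0 := by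
  ext i j
  rcases j with j | j
  · exact congrFun hv i
  · exact congrFun (congrFun hN i) j

theorem skew_mulVec (v w : V3) : skew v *ᵥ w = crossProduct v w := by
  ext i
  fin_cases i <;>
    simp [skew, mulVec, dotProduct, Fin.sum_univ_three, cross_apply] <;> ring

theorem IsRot.mul_transpose {R : M3} (hR : IsRot R) : R * Rᵀ = 1 :=
  mul_eq_one_comm.mp hR.1

theorem dotProduct_self_of_norm3_eq_one {v : V3} (hv : norm3 v = 1) : v ⬝ᵥ v = 1 :=
  Real.sqrt_eq_one.mp hv

theorem cols3_mulVec_e3 (a b c : V3) : cols3 a b c *ᵥ e3 = c := by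
  ext i
  simp [cols3, e3, mulVec, dotProduct, Fin.sum_univ_three]

/-- the linearized aided INS with one point and one plane feature has at
least 4 unobservable directions. -/
theorem point_plane_unobservable_directions
    (n np1 np2 g Pf P₁ V₁ Pk : V3) (d δt : ℝ) (R₁ : M3) (hR₁ : IsRot R₁)
    (hn : norm3 n = 1) (hd : d ≠ 0)
    (h11 : np1 ⬝ᵥ np1 = 1) (h22 : np2 ⬝ᵥ np2 = 1) (h12 : np1 ⬝ᵥ np2 = 0)
    (h1n : np1 ⬝ᵥ n = 0) (h2n : np2 ⬝ᵥ n = 0)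
    (Γ₂ Γ₄ A B : M3) :
    let cp : V3 := d • n
    let RPi : M3 := cols3 np1 np2 n
    let Γ₁ : M3 := skew (Pf - P₁ - δt • V₁ + (δt ^ 2 / 2) • g) * R₁
    let Γπ1 : M3 := ((d - n ⬝ᵥ Pk) • skew n
        - vecMulVec n n * skew (P₁ + δt • V₁ - (δt ^ 2 / 2) • g - Pk)) * R₁
    let Γπ4 : M3 := d⁻¹ • ((d - n ⬝ᵥ Pk) • (1 : M3) - vecMulVec n Pk
        + (2 * (n ⬝ᵥ Pk)) • vecMulVec n n)
    let Mp : Matrix (Fin 3) S21 ℝ :=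
      row7 Γ₁ Γ₂ ((-δt) • (1 : M3)) Γ₄ (-1) 1 0
    let Mπ : Matrix (Fin 3) S21 ℝ :=
      row7 Γπ1 A ((-δt) • vecMulVec n n) B (-(vecMulVec n n)) 0 Γπ4
    let Npπ : Matrix S21 (Fin 1 ⊕ Fin 3) ℝ :=
      Matrix.of fun s => Sum.elim
        (fun _ : Fin 1 =>
          col7v (R₁ᵀ *ᵥ g) 0 (-(skew V₁ *ᵥ g)) 0 (-(skew P₁ *ᵥ g))
            (-(skew Pf *ᵥ g)) (-(skew cp *ᵥ g)) s)
        (fun j : Fin 3 => stack7m 0 0 0 0 1 1 (vecMulVec n e3 * RPiᵀ) s j)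
    Mp * Npπ = 0 ∧ Mπ * Npπ = 0 := by
  intro cp RPi Γ₁ Γπ1 Γπ4 Mp Mπ Npπ
  have hnn : n ⬝ᵥ n = 1 := dotProduct_self_of_norm3_eq_one hn
  have hRR (X : M3) : (X * R₁) *ᵥ (R₁ᵀ *ᵥ g) = X *ᵥ g := by
    rw [mulVec_mulVec, Matrix.mul_assoc, hR₁.mul_transpose, Matrix.mul_one]
  have hRPi : vecMulVec n e3 * RPiᵀ = vecMulVec n n := by
    rw [vecMulVec_mul, vecMul_transpose, cols3_mulVec_e3]
  have hΓn : Γπ4 *ᵥ n = n := by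
    ext i
    simp [Γπ4, smul_mulVec, add_mulVec, sub_mulVec, vecMulVec_mulVec, hnn, dotProduct_comm Pk n]
    field_simp
    ring
  have hcross : Pk ⬝ᵥ crossProduct n g = -(n ⬝ᵥ crossProduct Pk g) := by
    simp [cross_apply, dotProduct, Fin.sum_univ_three]
    ring
  refine ⟨mul_of_sumElim_eq_zero _ _ _ ?_ ?_, mul_of_sumElim_eq_zero _ _ _ ?_ ?_⟩
  · rw [row7_mulVec_col7v, hRR]
    simp only [skew_mulVec, map_sub, map_add, map_smul, LinearMap.sub_apply, LinearMap.add_apply,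
      LinearMap.smul_apply, cross_self, mulVec_zero, smul_mulVec, neg_mulVec, one_mulVec,
      zero_mulVec]
    module
  · rw [row7_mul_stack7m]
    simp
  · rw [row7_mulVec_col7v, hRR]
    ext i
    simp [-cross_anticomm, Γπ4, cp, skew_mulVec, smul_mulVec, neg_mulVec, add_mulVec,
      sub_mulVec, mulVec_neg, ← mulVec_mulVec, vecMulVec_mulVec, dot_self_cross, hcross, mulVec_smul]
    field_simp
    ring
  · rw [row7_mul_stack7m, hRPi, mul_vecMulVec, hΓn]
    simp
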